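/- Let E be a nontrivial finite-dimensional real inner product space, K ∈ ℝ, N < 0, f : E → ℝ continuously differentiable, and let ξ : [0,T) → E be continuous and continuously differentiable on (0,T) such that for every z ∈ E and every t ∈ (0,T) (with ‖ξ(t) − z‖ < π√(N/K) when K < 0) the derivative D at t of s ↦ 𝔰_{K/N}(‖ξ(s) − z‖/2)² satisfies D + K·𝔰_{K/N}(‖ξ(t) − z‖/2)² ≤ (N/2)·(1 − f_N(z)/f_N(ξ(t))). Then for every z ∈ E and every t ∈ (0,T) with sup_{s ∈ [0,t]} ‖ξ(s) − z‖ < π√(N/K) when K < 0, one has the uniform regularizing bound f_N(z)/f_N(ξ(t)) ≥ 1 + (2K/(N·(exp(Kt) − 1)))·𝔰_{K/N}(‖ξ(0) − z‖/2)², where 2K/(N(exp(Kt) − 1)) is read as 2/(N t) when K = 0. -/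

import Mathlib

open Real
open scoped RealInnerProductSpace

/-- The comparison function `𝔰_κ`. -/
noncomputable def sk (κ θ : ℝ) : ℝ :=
  if 0 < κ then Real.sin (Real.sqrt κ * θ) / Real.sqrt κ
  else if κ = 0 then θ
  else Real.sinh (Real.sqrt (-κ) * θ) / Real.sqrt (-κ)

/-- The comparison function `𝔠_κ`. -/
noncomputable def ck (κ θ : ℝ) : ℝ :=
  if 0 < κ then Real.cos (Real.sqrt κ * θ)
  else if κ = 0 then 1
  else Real.cosh (Real.sqrt (-κ) * θ)

/-- The distortion coefficient `σ_κ^{(t)}(θ)`. -/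
noncomputable def sg (κ t θ : ℝ) : ℝ := if θ = 0 then t else sk κ (t * θ) / sk κ θ

open Filter Topology

lemma hasDerivAt_sk (κ θ : ℝ) : HasDerivAt (sk κ) (ck κ θ) θ := by
  unfold sk ck
  split_ifs with h1 h2
  · have hs : Real.sqrt κ ≠ 0 := (Real.sqrt_pos.2 h1).ne'
    have h := (((hasDerivAt_id θ).const_mul (Real.sqrt κ)).sin).div_const (Real.sqrt κ)
    refine HasDerivAt.congr_deriv h ?_
    simp only [id]
    field_simp
  · exact hasDerivAt_id θ
  · have h3 : 0 < -κ := by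
      rcases lt_trichotomy κ 0 with h | h | h
      · linarith
      · exact absurd h h2
      · exact absurd h h1
    have hs : Real.sqrt (-κ) ≠ 0 := (Real.sqrt_pos.2 h3).ne'
    have h := (((hasDerivAt_id θ).const_mul (Real.sqrt (-κ))).sinh).div_const (Real.sqrt (-κ))
    refine HasDerivAt.congr_deriv h ?_
    simp only [id]
    field_simp

lemma sk_zero' (κ : ℝ) : sk κ 0 = 0 := by
  unfold sk
  split_ifs <;> simp

lemma ck_zero' (κ : ℝ) : ck κ 0 = 1 := by
  unfold ck
  split_ifs <;> simp

lemma continuous_sk (κ : ℝ) : Continuous (sk κ) :=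
  continuous_iff_continuousAt.2 fun θ => (hasDerivAt_sk κ θ).continuousAt

lemma continuousAt_ck (κ : ℝ) : Continuous (ck κ) := by
  unfold ck
  split_ifs <;> fun_prop

lemma deriv_nonpos_of_right {G : ℝ → ℝ} {G' : ℝ} (hG : HasDerivAt G G' 0) (h0 : G 0 = 0)
    (h : ∀ᶠ e in 𝓝[>] (0:ℝ), G e ≤ 0) : G' ≤ 0 := by
  have h1 := hG.tendsto_slope_zero_right
  refine le_of_tendsto h1 ?_
  filter_upwards [h, self_mem_nhdsWithin] with e he hpos
  have hpos' : 0 < e := hpos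
  simp only [zero_add, h0, sub_zero, smul_eq_mul]
  exact mul_nonpos_of_nonneg_of_nonpos (inv_nonneg.2 hpos'.le) he

/-- Product of a function vanishing at zero with a continuous one. -/
lemma hasDerivAt_mul_of_zero {p q : ℝ → ℝ} {p' : ℝ} (hp : HasDerivAt p p' 0) (h0 : p 0 = 0)
    (hq : ContinuousAt q 0) : HasDerivAt (fun e => p e * q e) (p' * q 0) 0 := by
  rw [hasDerivAt_iff_tendsto_slope] at hp ⊢
  have h2 := hp.mul (hq.tendsto.mono_left (nhdsWithin_le_nhds (s := {0}ᶜ)))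
  refine h2.congr ?_
  intro e
  simp only [slope_def_field, h0]
  ring

lemma evi_descent {E : Type*} [NormedAddCommGroup E] [InnerProductSpace ℝ E]
    (f : E → ℝ) (hf : ContDiff ℝ 1 f) (K N : ℝ) (hN : N < 0)
    (t : ℝ) (ξ : ℝ → E) (v : E)
    (hξd : HasDerivAt ξ v t)
    (hEVI : ∀ z : E, (K < 0 → ‖ξ t - z‖ < π * Real.sqrt (N / K)) →
      ∃ D : ℝ, HasDerivAt (fun s => sk (K / N) (‖ξ s - z‖ / 2) ^ 2) D t ∧
        D + K * sk (K / N) (‖ξ t - z‖ / 2) ^ 2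
          ≤ N / 2 * (1 - Real.exp (-f z / N) / Real.exp (-f (ξ t) / N))) :
    fderiv ℝ f (ξ t) v ≤ 0 := by
  by_cases hv : v = 0
  · simp [hv]
  have ha : 0 < ‖v‖ := norm_pos_iff.2 hv
  set a := ‖v‖ with ha_def
  set κ := K / N with hκ
  -- the first-order expansion
  let p : ℝ → ℝ := fun e => sk κ (e * a / 2)
  have hp : HasDerivAt p (a / 2) 0 := by
    have h1 : HasDerivAt (fun e : ℝ => e * a / 2) (a / 2) 0 := by
      have := ((hasDerivAt_id (0:ℝ)).mul_const a).div_const 2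
      simpa using this
    have h2 := HasDerivAt.comp (0:ℝ) (hasDerivAt_sk κ (0 * a / 2)) h1
    have h3 : (0:ℝ) * a / 2 = 0 := by ring
    rw [h3, ck_zero', one_mul] at h2
    exact h2
  have hp0 : p 0 = 0 := by simp [p, sk_zero']
  have hq : ContinuousAt (fun e : ℝ => ck κ (e * a / 2) * a) 0 := by
    have := continuousAt_ck κ
    fun_prop
  have hA := hasDerivAt_mul_of_zero hp hp0 hq
  have hB := hasDerivAt_mul_of_zero hp hp0 (hp.continuousAt.const_mul K)
  have hC : HasDerivAt (fun e : ℝ => Real.exp (-f (ξ t - e • v) / N) / Real.exp (-f (ξ t) / N))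
      (fderiv ℝ f (ξ t) v / N) 0 := by
    have h1 : HasDerivAt (fun e : ℝ => ξ t - e • v) (-v) 0 := by
      have := ((hasDerivAt_id (0:ℝ)).smul_const v).const_sub (ξ t)
      simpa using this
    have hfd : HasFDerivAt f (fderiv ℝ f (ξ t)) (ξ t - (0:ℝ) • v) := by
      have := (hf.differentiable one_ne_zero (ξ t)).hasFDerivAt
      simpa using this
    have h2 := HasFDerivAt.comp_hasDerivAt (0:ℝ) hfd h1
    have h3 := ((h2.neg.div_const N).exp).div_const (Real.exp (-f (ξ t) / N))
    refine HasDerivAt.congr_deriv h3 ?_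
    have := (Real.exp_pos (-f (ξ t) / N)).ne'
    simp
  have hG := (hA.add hB).sub ((hC.const_sub 1).const_mul (N / 2))
  have key := deriv_nonpos_of_right hG ?_ ?_
  · have e1 : (0:ℝ) * a / 2 = 0 := by ring
    simp only [hp0, e1, ck_zero', mul_zero, add_zero, one_mul] at key
    have e2 : N / 2 * -(fderiv ℝ f (ξ t) v / N) = -(fderiv ℝ f (ξ t) v / 2) := by
      have := hN.ne
      field_simp
    rw [e2] at key
    nlinarith [mul_pos ha ha]
  · simp [hp0]
  · have hev : ∀ᶠ e in 𝓝[>] (0:ℝ), (K < 0 → e * a < π * Real.sqrt (N / K)) := by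
      by_cases hK : K < 0
      · have hpos : 0 < π * Real.sqrt (N / K) :=
          mul_pos Real.pi_pos (Real.sqrt_pos.2 (div_pos_of_neg_of_neg hN hK))
        have hc : Continuous (fun e : ℝ => e * a) := by fun_prop
        have := (hc.tendsto 0).eventually
          (Iio_mem_nhds (show (0:ℝ) * a < π * Real.sqrt (N / K) by simpa using hpos))
        filter_upwards [nhdsWithin_le_nhds this] with e he _
        exact he
      · exact Eventually.of_forall fun e h => absurd h hK
    filter_upwards [hev, self_mem_nhdsWithin] with e he hpos
    have hpos' : 0 < e := hpos
    have hz : ξ t - (ξ t - e • v) = e • v := by abel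
    have hn : ‖ξ t - (ξ t - e • v)‖ = e * a := by
      rw [hz, norm_smul, Real.norm_of_nonneg hpos'.le]
    obtain ⟨D, hD, hle⟩ := hEVI (ξ t - e • v) (by rw [hn]; exact he)
    have hne : ξ t - (ξ t - e • v) ≠ 0 := by
      rw [hz]; exact smul_ne_zero hpos'.ne' hv
    have hnd : HasDerivAt (fun s => ‖ξ s - (ξ t - e • v)‖) a t := by
      have h1 := (hξd.sub_const (ξ t - e • v)).norm_sq
      have h2 := h1.sqrt (by positivity)
      have h3 : (fun s => Real.sqrt (‖ξ s - (ξ t - e • v)‖ ^ 2))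
          = fun s => ‖ξ s - (ξ t - e • v)‖ := by
        funext s; exact Real.sqrt_sq (norm_nonneg _)
      rw [h3] at h2
      refine HasDerivAt.congr_deriv h2 ?_
      rw [Real.sqrt_sq (norm_nonneg _), hn, hz, real_inner_smul_left,
        real_inner_self_eq_norm_sq, ← ha_def]
      field_simp
    have hD2 : HasDerivAt (fun s => sk κ (‖ξ s - (ξ t - e • v)‖ / 2) ^ 2)
        (p e * (ck κ (e * a / 2) * a)) t := by
      have h4 := HasDerivAt.comp t (hasDerivAt_sk κ (‖ξ t - (ξ t - e • v)‖ / 2)) (hnd.div_const 2)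
      have h5 := h4.pow 2
      refine HasDerivAt.congr_deriv h5 ?_
      simp only [Function.comp, hn, p]
      push_cast
      ring
    have hDe := hD.unique hD2
    rw [hn, hDe] at hle
    simp only [Pi.add_apply, Pi.sub_apply, p] at hle ⊢
    linarith [hle]

theorem stmt_14 {E : Type*} [NormedAddCommGroup E] [InnerProductSpace ℝ E]
    [FiniteDimensional ℝ E] [Nontrivial E]
    (f : E → ℝ) (hf : ContDiff ℝ 1 f) (K N : ℝ) (hN : N < 0)
    (T : ℝ) (ξ ξ' : ℝ → E)
    (hξc : ContinuousOn ξ (Set.Ico 0 T))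
    (hξd : ∀ t ∈ Set.Ioo (0:ℝ) T, HasDerivAt ξ (ξ' t) t)
    (hξ'c : ContinuousOn ξ' (Set.Ioo 0 T))
    (hEVI : ∀ z : E, ∀ t ∈ Set.Ioo (0:ℝ) T, (K < 0 → ‖ξ t - z‖ < π * Real.sqrt (N / K)) →
      ∃ D : ℝ, HasDerivAt (fun s => sk (K / N) (‖ξ s - z‖ / 2) ^ 2) D t ∧
        D + K * sk (K / N) (‖ξ t - z‖ / 2) ^ 2
          ≤ N / 2 * (1 - Real.exp (-f z / N) / Real.exp (-f (ξ t) / N))) :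
    ∀ z : E, ∀ t ∈ Set.Ioo (0:ℝ) T,
      (K < 0 → ∀ s ∈ Set.Icc (0:ℝ) t, ‖ξ s - z‖ < π * Real.sqrt (N / K)) →
      1 + (if K = 0 then 2 / (N * t) else 2 * K / (N * (Real.exp (K * t) - 1))) *
          sk (K / N) (‖ξ 0 - z‖ / 2) ^ 2
        ≤ Real.exp (-f z / N) / Real.exp (-f (ξ t) / N) := by
  intro z t ht hdist
  have hanti : AntitoneOn (fun s => f (ξ s)) (Set.Ioo 0 T) := by
    have hd : ∀ s ∈ Set.Ioo (0:ℝ) T,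
        HasDerivAt (fun s => f (ξ s)) (fderiv ℝ f (ξ s) (ξ' s)) s := fun s hs =>
      HasFDerivAt.comp_hasDerivAt s (hf.differentiable one_ne_zero (ξ s)).hasFDerivAt (hξd s hs)
    refine antitoneOn_of_deriv_nonpos (convex_Ioo 0 T)
      (fun s hs => (hd s hs).continuousAt.continuousWithinAt) ?_ ?_
    · intro s hs
      rw [interior_Ioo] at hs
      exact (hd s hs).differentiableAt.differentiableWithinAt
    · intro s hs
      rw [interior_Ioo] at hs
      rw [(hd s hs).deriv]
      exact evi_descent f hf K N hN s ξ (ξ' s) (hξd s hs) (fun z => hEVI z s hs)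
  set R := Real.exp (-f z / N) / Real.exp (-f (ξ t) / N) with hR
  obtain ⟨W, hW, hW0, hWt, hWe⟩ : ∃ W : ℝ → ℝ, (∀ s, HasDerivAt W (Real.exp (K * s)) s) ∧
      W 0 = 0 ∧ 0 < W t ∧
      (if K = 0 then 2 / (N * t) else 2 * K / (N * (Real.exp (K * t) - 1))) = 2 / (N * W t) := by
    by_cases hK : K = 0
    · refine ⟨fun s => s, ?_, rfl, ht.1, by simp [hK]⟩
      intro s
      simpa [hK] using hasDerivAt_id' s
    · refine ⟨fun s => (Real.exp (K * s) - 1) / K, ?_, by simp, ?_, ?_⟩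
      · intro s
        have h := ((((hasDerivAt_id s).const_mul K).exp).sub_const 1).div_const K
        refine HasDerivAt.congr_deriv h ?_
        simp only [id]
        field_simp
      · rcases lt_or_gt_of_ne hK with h | h
        · apply div_pos_of_neg_of_neg _ h
          have : Real.exp (K * t) < 1 := by
            rw [← Real.exp_zero]
            exact Real.exp_lt_exp.2 (mul_neg_of_neg_of_pos h ht.1)
          linarith
        · apply div_pos _ h
          have : 1 < Real.exp (K * t) := Real.one_lt_exp_iff.2 (mul_pos h ht.1)
          linarith
      · rw [if_neg hK]
        have h1 : Real.exp (K * t) - 1 ≠ 0 := by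
          intro h
          have h2 : Real.exp (K * t) = 1 := by linarith
          rw [Real.exp_eq_one_iff] at h2
          exact (mul_ne_zero hK ht.1.ne') h2
        have := hN.ne
        field_simp
  rw [hWe]
  set u : ℝ → ℝ := fun s => sk (K / N) (‖ξ s - z‖ / 2) ^ 2 with hu
  have hg : AntitoneOn (fun s => Real.exp (K * s) * u s - N / 2 * (1 - R) * W s)
      (Set.Icc 0 t) := by
    have hd : ∀ s ∈ Set.Ioo (0:ℝ) t, ∃ D : ℝ,
        HasDerivAt (fun s => Real.exp (K * s) * u s - N / 2 * (1 - R) * W s) D s ∧ D ≤ 0 := by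
      intro s hs
      have hsT : s ∈ Set.Ioo (0:ℝ) T := ⟨hs.1, hs.2.trans ht.2⟩
      obtain ⟨D, hD, hle⟩ := hEVI z s hsT (fun hK => hdist hK s ⟨hs.1.le, hs.2.le⟩)
      have he : HasDerivAt (fun s => Real.exp (K * s)) (Real.exp (K * s) * K) s := by
        have h := ((hasDerivAt_id s).const_mul K).exp
        simpa using h
      refine ⟨_, (he.mul hD).sub ((hW s).const_mul (N / 2 * (1 - R))), ?_⟩
      have hff : f (ξ t) ≤ f (ξ s) := hanti hsT ht hs.2.le
      have hRs : Real.exp (-f z / N) / Real.exp (-f (ξ s) / N) ≤ R := by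
        rw [hR]
        apply div_le_div_of_nonneg_left (Real.exp_pos _).le (Real.exp_pos _)
        apply Real.exp_le_exp.2
        apply div_le_div_of_nonpos_of_le hN.le
        linarith
      have h3 : N / 2 * (1 - Real.exp (-f z / N) / Real.exp (-f (ξ s) / N)) ≤ N / 2 * (1 - R) :=
        mul_le_mul_of_nonpos_left (by linarith) (by linarith)
      have h4 := mul_le_mul_of_nonneg_left (hle.trans h3) (Real.exp_pos (K * s)).le
      linarith
    refine antitoneOn_of_deriv_nonpos (convex_Icc 0 t) ?_ ?_ ?_
    · have hξ1 : ContinuousOn ξ (Set.Icc 0 t) :=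
        hξc.mono fun s hs => ⟨hs.1, hs.2.trans_lt ht.2⟩
      have hWc : Continuous W := continuous_iff_continuousAt.2 fun s => (hW s).continuousAt
      have huc : ContinuousOn u (Set.Icc 0 t) :=
        ((continuous_sk (K / N)).comp_continuousOn
          ((hξ1.sub continuousOn_const).norm.div_const 2)).pow 2
      have hec : Continuous fun s : ℝ => Real.exp (K * s) := by fun_prop
      exact (hec.continuousOn.mul huc).sub (hWc.const_mul (N / 2 * (1 - R))).continuousOn
    · intro s hs
      rw [interior_Icc] at hs
      obtain ⟨D, hD, -⟩ := hd s hs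
      exact hD.differentiableAt.differentiableWithinAt
    · intro s hs
      rw [interior_Icc] at hs
      obtain ⟨D, hD, h⟩ := hd s hs
      rw [hD.deriv]
      exact h
  have hfin := hg (Set.left_mem_Icc.2 ht.1.le) (Set.right_mem_Icc.2 ht.1.le) ht.1.le
  simp only [hW0, mul_zero, Real.exp_zero, one_mul, sub_zero] at hfin
  have hut : 0 ≤ Real.exp (K * t) * u t := mul_nonneg (Real.exp_pos _).le (sq_nonneg _)
  have h5 : 0 ≤ u 0 + N / 2 * (1 - R) * W t := by linarith
  change 1 + 2 / (N * W t) * u 0 ≤ R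
  have h6 : N * W t < 0 := mul_neg_of_neg_of_pos hN hWt
  have h7 : 2 / (N * W t) * (u 0 + N / 2 * (1 - R) * W t) ≤ 0 :=
    mul_nonpos_of_nonpos_of_nonneg (div_nonpos_of_nonneg_of_nonpos (by norm_num) h6.le) h5
  have h8 : 2 / (N * W t) * (u 0 + N / 2 * (1 - R) * W t) = 2 / (N * W t) * u 0 + (1 - R) := by
    have := hN.ne
    have := hWt.ne'
    field_simp
  linarith
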